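/- arXiv:2008.08530 — 3 statements merged into one kernel-verified Lean document; each statement's English description precedes it below -/
import Mathlib

section
/- Let 𝒲 be a category with terminal object ⊤, L : 𝒲 ⥤ 𝒱 a functor, U an object of 𝒱, and e : L.obj ⊤ ≅ U (so L is a multiplier for U); write π₂(W) = L.map(!_W) ≫ e.hom and let fresh : 𝒲 ⥤ Over U send W to the slice (L.obj W, π₂(W)). If fresh is full and faithful (the multiplier is cancellative and affine), then for every object W₀ of 𝒲 the induced slice functor Over.post L : Over W₀ ⥤ Over (L.obj W₀), sending (W, ψ : W ⟶ W₀) to (L.obj W, L.map ψ), is full (the multiplier is strongly affine). -/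
open CategoryTheory CategoryTheory.Limits

universe w v v' u u'

variable {𝒲 : Type u} [Category.{v} 𝒲] [HasTerminal 𝒲]
variable {𝒱 : Type u'} [Category.{v'} 𝒱]

/-- The second projection of a multiplier `L` for `U` (with `e : L.obj ⊤ ≅ U`). -/
noncomputable def Multiplier.pi2 (L : 𝒲 ⥤ 𝒱) (U : 𝒱) (e : L.obj (⊤_ 𝒲) ≅ U) (W : 𝒲) :
    L.obj W ⟶ U :=
  L.map (terminal.from W) ≫ e.hom

/-- The fresh weakening functor of a multiplier. -/
noncomputable def Multiplier.fresh (L : 𝒲 ⥤ 𝒱) (U : 𝒱) (e : L.obj (⊤_ 𝒲) ≅ U) : 𝒲 ⥤ Over U where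
  obj W := Over.mk (Multiplier.pi2 L U e W)
  map {W W'} f := Over.homMk (L.map f) (by
    simp only [Multiplier.pi2, Over.mk_hom, ← Category.assoc, ← L.map_comp, terminal.comp_from])

/-- A morphism `φ : V ⟶ U` is dimensionally split if some `pi2 W` factors through it. -/
def Multiplier.DimSplit (L : 𝒲 ⥤ 𝒱) (U : 𝒱) (e : L.obj (⊤_ 𝒲) ≅ U) {V : 𝒱} (φ : V ⟶ U) : Prop :=
  ∃ (W : 𝒲) (χ : L.obj W ⟶ V), χ ≫ φ = Multiplier.pi2 L U e W

/-- A cancellative affine multiplier is strongly affine. -/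
theorem stronglyAffine_of_cancellative_affine
    (L : 𝒲 ⥤ 𝒱) (U : 𝒱) (e : L.obj (⊤_ 𝒲) ≅ U)
    (hfaithful : (Multiplier.fresh L U e).Faithful)
    (hfull : (Multiplier.fresh L U e).Full) :
    ∀ W₀ : 𝒲, (Over.post (X := W₀) L).Full := by
  intro W₀
  have natural : ∀ {A B : 𝒲} (f : A ⟶ B),
      L.map f ≫ Multiplier.pi2 L U e B = Multiplier.pi2 L U e A := by
    intro A B f
    simp only [Multiplier.pi2, ← Category.assoc, ← L.map_comp, terminal.comp_from]
  constructor
  intro A B g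
  obtain ⟨k, hk, hg⟩ : ∃ k : L.obj A.left ⟶ L.obj B.left,
      k = g.left ∧ k ≫ L.map B.hom = L.map A.hom := ⟨g.left, rfl, Over.w g⟩
  have hpi : k ≫ Multiplier.pi2 L U e B.left = Multiplier.pi2 L U e A.left := by
    rw [← natural B.hom, ← Category.assoc, hg, natural]
  obtain ⟨f, hf⟩ := hfull.map_surjective
    (Over.homMk k hpi :
      (Multiplier.fresh L U e).obj A.left ⟶ (Multiplier.fresh L U e).obj B.left)
  have hf' : L.map f = k := congrArg CommaMorphism.left hf
  have hw : f ≫ B.hom = A.hom := by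
    apply hfaithful.map_injective
    apply Over.OverMorphism.ext
    change L.map (f ≫ B.hom) = L.map A.hom
    rw [L.map_comp, hf', hg]
  exact ⟨Over.homMk f hw, Over.OverMorphism.ext (hf'.trans hk)⟩
end

section
/- Let 𝒲 be a category with terminal object ⊤, L : 𝒲 ⥤ 𝒱 a functor, U an object of 𝒱, and e : L.obj ⊤ ≅ U (so L is a multiplier for U); write π₂(W) = L.map(!_W) ≫ e.hom and let fresh : 𝒲 ⥤ Over U send W to the slice (L.obj W, π₂(W)). If fresh has a left adjoint (the multiplier is quantifiable), then for every object W₀ of 𝒲 the induced slice functor Over.post L : Over W₀ ⥤ Over (L.obj W₀), sending (W, ψ : W ⟶ W₀) to (L.obj W, L.map ψ), also has a left adjoint (the multiplier is strongly quantifiable). -/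
open CategoryTheory CategoryTheory.Limits

universe w v v' u u'

variable {𝒲 : Type u} [Category.{v} 𝒲] [HasTerminal 𝒲]
variable {𝒱 : Type u'} [Category.{v'} 𝒱]

/-- A quantifiable multiplier is strongly quantifiable. -/
theorem stronglyQuantifiable_of_quantifiable
    (L : 𝒲 ⥤ 𝒱) (U : 𝒱) (e : L.obj (⊤_ 𝒲) ≅ U)
    (hq : (Multiplier.fresh L U e).IsRightAdjoint) :
    ∀ W₀ : 𝒲, (Over.post (X := W₀) L).IsRightAdjoint := by
  intro W₀
  have a := Over.postAdjunctionRight (Y := W₀)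
    (Adjunction.ofIsRightAdjoint (Multiplier.fresh L U e))
  have b := (Over.iteratedSliceEquiv ((Multiplier.fresh L U e).obj W₀)).symm.toAdjunction.comp a
  have h : (Over.post (X := W₀) (Multiplier.fresh L U e) ⋙
      Over.iteratedSliceForward ((Multiplier.fresh L U e).obj W₀)).IsRightAdjoint :=
    b.isRightAdjoint
  exact h
end

section
/- Let 𝒲 be a category with terminal object ⊤, L : 𝒲 ⥤ 𝒱 a functor, U an object of 𝒱, and e : L.obj ⊤ ≅ U; write π₂(W) = L.map(!_W) ≫ e.hom, let fresh : 𝒲 ⥤ Over U send W to the slice (L.obj W, π₂(W)), and call φ : V ⟶ U dimensionally split if there exist W and χ : L.obj W ⟶ V with χ ≫ φ = π₂(W). Suppose fresh is full (affine) and every slice (V, φ) with φ dimensionally split is isomorphic in Over U to fresh.obj W for some W (connection-free). Then the multiplier is strongly connection-free: for every object W₀ of 𝒲 and every slice (V, φ : V ⟶ L.obj W₀) such that φ ≫ π₂(W₀) is dimensionally split, there exist W and ψ : W ⟶ W₀ and an isomorphism (V, φ) ≅ (L.obj W, L.map ψ) in Over (L.obj W₀). -/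
open CategoryTheory CategoryTheory.Limits

universe w v v' u u'

variable {𝒲 : Type u} [Category.{v} 𝒲] [HasTerminal 𝒲]
variable {𝒱 : Type u'} [Category.{v'} 𝒱]

/-- An affine connection-free multiplier is strongly connection-free. -/
theorem stronglyConnectionFree_of_affine_connectionFree
    (L : 𝒲 ⥤ 𝒱) (U : 𝒱) (e : L.obj (⊤_ 𝒲) ≅ U)
    (hfull : (Multiplier.fresh L U e).Full)
    (hcf : ∀ (V : 𝒱) (φ : V ⟶ U), Multiplier.DimSplit L U e φ →
        ∃ W : 𝒲, Nonempty (Over.mk φ ≅ (Multiplier.fresh L U e).obj W)) :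
    ∀ (W₀ : 𝒲) (V : 𝒱) (φ : V ⟶ L.obj W₀),
      Multiplier.DimSplit L U e (φ ≫ Multiplier.pi2 L U e W₀) →
      ∃ (W : 𝒲) (ψ : W ⟶ W₀),
        Nonempty ((Over.mk φ : Over (L.obj W₀)) ≅ Over.mk (L.map ψ)) := by
  intro W₀ V φ h
  obtain ⟨W, ⟨i⟩⟩ := hcf V _ h
  let g : Over.mk (φ ≫ Multiplier.pi2 L U e W₀) ⟶ (Multiplier.fresh L U e).obj W₀ :=
    Over.homMk φ rfl
  obtain ⟨ψ, hψ⟩ := hfull.map_surjective (i.inv ≫ g)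
  have h1 : L.map ψ = i.inv.left ≫ φ := congrArg (fun f => f.left) hψ
  have h2 : i.hom.left ≫ i.inv.left = 𝟙 V := congrArg (fun f => f.left) i.hom_inv_id
  refine ⟨W, ψ, ⟨Over.isoMk ((Over.forget U).mapIso i) ?_⟩⟩
  change i.hom.left ≫ L.map ψ = φ
  rw [h1]
  exact (Category.assoc _ _ _).symm.trans ((congrArg (fun k => k ≫ φ) h2).trans (Category.id_comp φ))
end
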